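/- arXiv:2509.23002 — 2 statements merged into one kernel-verified Lean document; each statement's English description precedes it below -/
import Mathlib

section
/- (Split-UCP marginal coverage) Let (Ω, 𝔽, P) be a probability space, E a measurable space, and Y_1, …, Y_{n+1} : Ω → E exchangeable random variables. Let I_1, I_2 be disjoint subsets of {1, …, n} with I_1 ∪ I_2 = {1, …, n} and |I_2| = n₂ ≥ 1. Let φ : E × (I_1 → E) → ℝ be measurable, and define residuals R_i := φ(Y_i, (Y_j)_{j ∈ I_1}) for i ∈ I_2 ∪ {n+1}. Let α ∈ (0,1), set k := ⌈(1−α)(n₂+1)⌉, assume k ≤ n₂, and let q be the k-th order statistic of the multiset {R_i : i ∈ I_2}. Then P(R_{n+1} ≤ q) ≥ 1 − α. -/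
open MeasureTheory

/-- The `k`-th order statistic (k-th smallest, `k` 1-indexed) of a finite multiset of reals. -/
noncomputable def orderStat (s : Multiset ℝ) (k : ℕ) : ℝ :=
  (s.sort (· ≤ ·)).getD (k - 1) 0

/-- A real with fewer than `k` elements of `s` strictly below it is at most the `k`-th order
statistic of `s`. -/
lemma le_orderStat_of_countP_lt (s : Multiset ℝ) (k : ℕ) (a : ℝ) (hks : k ≤ s.card)
    (h : s.countP (· < a) < k) : a ≤ orderStat s k := by
  by_contra! hlt
  set l := s.sort (· ≤ ·) with hl
  have hlen : l.length = s.card := Multiset.length_sort _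
  have hlk : k - 1 < l.length := by omega
  have hsorted : l.Pairwise (· ≤ ·) := Multiset.pairwise_sort s (· ≤ ·)
  have hlt' : l[k - 1] < a := by
    rw [orderStat, ← hl, List.getD_eq_getElem _ _ hlk] at hlt
    exact hlt
  have hcount : l.countP (· < a) = s.countP (· < a) := by
    rw [← Multiset.coe_countP, hl, Multiset.sort_eq]
  have htake : (l.take k).countP (· < a) = (l.take k).length := by
    rw [List.countP_eq_length]
    intro x hx
    obtain ⟨i, hi, rfl⟩ := List.mem_take_iff_getElem.1 hx
    have hle : l[i] ≤ l[k - 1] :=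
      hsorted.rel_get_of_le (a := ⟨i, by omega⟩) (b := ⟨k - 1, hlk⟩) (by
        simp only [Fin.mk_le_mk]; omega)
    simpa using hle.trans_lt hlt'
  have hsub := (List.take_sublist k l).countP_le (p := (· < a))
  rw [htake, List.length_take] at hsub
  omega

/-- Among the elements of `J`, at least `k` have fewer than `k` elements of `J` with a strictly
smaller value. -/
lemma le_card_filter_card_filter_lt {ι : Type*} (J : Finset ι) (r : ι → ℝ) (k : ℕ)
    (hk : k ≤ J.card) :
    k ≤ (J.filter fun j => (J.filter fun i => r i < r j).card < k).card := by
  classical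
  by_contra! hlt
  set S := J.filter fun j => (J.filter fun i => r i < r j).card < k with hS
  have hne : (J \ S).Nonempty := by
    rw [Finset.sdiff_nonempty]
    intro hsub
    have := Finset.card_le_card hsub
    omega
  obtain ⟨m, hm, hmin⟩ := (J \ S).exists_min_image r hne
  rw [Finset.mem_sdiff] at hm
  refine hm.2 (Finset.mem_filter.2 ⟨hm.1, lt_of_le_of_lt (Finset.card_le_card ?_) hlt⟩)
  intro i hi
  rw [Finset.mem_filter] at hi
  by_contra hiS
  exact absurd (hmin i (Finset.mem_sdiff.2 ⟨hi.1, hiS⟩)) (not_le.2 hi.2)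

/-- The set of points at which fewer than `k` of the functions `r i`, `i ∈ J`, lie strictly below
`r j` is measurable. -/
lemma measurableSet_card_filter_lt {ι X : Type*} [MeasurableSpace X] (J : Finset ι)
    (r : ι → X → ℝ) (hr : ∀ i, Measurable (r i)) (j : ι) (k : ℕ) :
    MeasurableSet {x | (J.filter fun i => r i x < r j x).card < k} := by
  simp only [Finset.card_filter]
  refine measurableSet_lt (Finset.measurable_sum _ fun i _ => ?_) measurable_const
  exact Measurable.ite (measurableSet_lt (hr i) (hr j)) measurable_const measurable_const

/-- If every point lies in at least `k` of the sets `A j`, `j ∈ J`, then the measures of these sets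
under a probability measure sum to at least `k`. -/
lemma le_sum_measure_of_le_card_filter {ι X : Type*} [MeasurableSpace X] (μ : Measure X)
    [IsProbabilityMeasure μ] (J : Finset ι) (A : ι → Set X) [∀ j x, Decidable (x ∈ A j)]
    (hA : ∀ j, MeasurableSet (A j)) (k : ℕ) (h : ∀ x, k ≤ (J.filter fun j => x ∈ A j).card) :
    (k : ENNReal) ≤ ∑ j ∈ J, μ (A j) := by
  calc (k : ENNReal) = ∫⁻ _, (k : ENNReal) ∂μ := by simp
    _ ≤ ∫⁻ x, ∑ j ∈ J, (A j).indicator 1 x ∂μ := by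
      refine lintegral_mono fun x => ?_
      have hx : ∑ j ∈ J, (A j).indicator (1 : X → ENNReal) x
          = ((J.filter fun j => x ∈ A j).card : ENNReal) := by
        simp [Set.indicator_apply, Finset.sum_boole]
      rw [hx]
      exact Nat.cast_le.2 (h x)
    _ = ∑ j ∈ J, μ (A j) := by
      rw [lintegral_finsetSum _ fun j _ => measurable_one.indicator (hA j)]
      simp [lintegral_indicator_one (hA _)]

/-- Under an exchangeable law, each residual outside the index set `I` used by the score is equally
likely to have fewer than `k` residuals strictly below it. -/
lemma measure_card_filter_lt_eq_of_exchangeable {ι E : Type*} [DecidableEq ι] [MeasurableSpace E]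
    (μ : Measure (ι → E))
    (hμ : ∀ σ : Equiv.Perm ι, μ.map (fun y i => y (σ i)) = μ)
    (I J : Finset ι) (hIJ : Disjoint I J) (φ : E × (↥I → E) → ℝ) (hφ : Measurable φ)
    (k : ℕ) {j l : ι} (hj : j ∈ J) (hl : l ∈ J) :
    μ {y | (J.filter fun i => φ (y i, fun a : ↥I => y a) < φ (y j, fun a : ↥I => y a)).card < k}
      = μ {y | (J.filter fun i =>
          φ (y i, fun a : ↥I => y a) < φ (y l, fun a : ↥I => y a)).card < k} := by
  have hmeas : MeasurableSet {y : ι → E | (J.filter fun i =>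
      φ (y i, fun a : ↥I => y a) < φ (y l, fun a : ↥I => y a)).card < k} :=
    measurableSet_card_filter_lt J (fun i (y : ι → E) => φ (y i, fun a : ↥I => y a))
      (fun i => by fun_prop) l k
  set σ := Equiv.swap j l with hσ
  conv_rhs => rw [← hμ σ, Measure.map_apply (by fun_prop) hmeas]
  congr 1
  ext y
  have hfix : (fun a : ↥I => y (σ a)) = fun a : ↥I => y a := by
    funext a
    have ha : ∀ b ∈ J, (a : ι) ≠ b := fun b hb => Finset.disjoint_iff_ne.1 hIJ a a.2 b hb
    rw [hσ, Equiv.swap_apply_of_ne_of_ne (ha j hj) (ha l hl)]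
  have hσJ : ∀ i, σ i ∈ J ↔ i ∈ J := by
    intro i
    rw [hσ, Equiv.swap_apply_def]
    split_ifs with h₁ h₂ <;> simp_all
  have hσl : σ l = j := Equiv.swap_apply_right j l
  simp only [Set.mem_ofPred_eq, Set.preimage_ofPred_eq, hfix, hσl]
  have hcard : (J.filter fun i =>
        φ (y (σ i), fun a : ↥I => y a) < φ (y j, fun a : ↥I => y a)).card
      = (J.filter fun i => φ (y i, fun a : ↥I => y a) < φ (y j, fun a : ↥I => y a)).card :=
    Finset.card_equiv σ fun i => by simp [hσJ]
  rw [hcard]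

/-- Split-UCP marginal coverage: For exchangeable `Y 1, …, Y (n+1)`,
a partition `I₁ ∪ I₂` of `{1, …, n}`, a measurable score `φ : E × (I₁ → E) → ℝ`,
residuals `R i = φ (Y i, (Y j)_{j ∈ I₁})`, and `q` the `k`-th order statistic with
`k = ⌈(1-α)(n₂+1)⌉ ≤ n₂ = |I₂|`, we have `P(R (n+1) ≤ q) ≥ 1 - α`. -/
theorem split_ucp_marginal_coverage
    {Ω E : Type*} [MeasurableSpace Ω] [MeasurableSpace E]
    (P : Measure Ω) [IsProbabilityMeasure P]
    (n : ℕ) (Y : Fin (n + 1) → Ω → E) (hY : ∀ i, Measurable (Y i))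
    (hexch : ∀ σ : Equiv.Perm (Fin (n + 1)),
      Measure.map (fun ω (i : Fin (n + 1)) => Y (σ i) ω) P
        = Measure.map (fun ω (i : Fin (n + 1)) => Y i ω) P)
    (I₁ I₂ : Finset (Fin (n + 1)))
    (hdisj : Disjoint I₁ I₂)
    (hunion : I₁ ∪ I₂ = Finset.univ.erase (Fin.last n))
    (hn₂ : 1 ≤ I₂.card)
    (φ : E × (↥I₁ → E) → ℝ) (hφ : Measurable φ)
    (α : ℝ) (hα : α ∈ Set.Ioo (0 : ℝ) 1)
    (hk : ⌈(1 - α) * ((I₂.card : ℝ) + 1)⌉₊ ≤ I₂.card) :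
    ENNReal.ofReal (1 - α) ≤
      P {ω | φ (Y (Fin.last n) ω, fun i : ↥I₁ => Y i ω) ≤
        orderStat (I₂.val.map fun i => φ (Y i ω, fun j : ↥I₁ => Y j ω))
          ⌈(1 - α) * ((I₂.card : ℝ) + 1)⌉₊} := by
  classical
  set k := ⌈(1 - α) * ((I₂.card : ℝ) + 1)⌉₊ with hkdef
  set L := Fin.last n with hL
  set J := insert L I₂ with hJ
  have hlast : L ∉ I₁ ∪ I₂ := by simp [hunion]
  rw [Finset.mem_union, not_or] at hlast
  have hcardJ : J.card = I₂.card + 1 := Finset.card_insert_of_notMem hlast.2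
  have hIJ : Disjoint I₁ J := Finset.disjoint_insert_right.2 ⟨hlast.1, hdisj⟩
  have hYm : Measurable fun ω (i : Fin (n + 1)) => Y i ω := measurable_pi_lambda _ hY
  set μ := P.map fun ω (i : Fin (n + 1)) => Y i ω with hμdef
  have : IsProbabilityMeasure μ := Measure.isProbabilityMeasure_map hYm.aemeasurable
  have hμ : ∀ σ : Equiv.Perm (Fin (n + 1)), μ.map (fun y i => y (σ i)) = μ := by
    intro σ
    rw [hμdef, Measure.map_map (by fun_prop) hYm]
    exact hexch σ
  let r : Fin (n + 1) → (Fin (n + 1) → E) → ℝ := fun i y => φ (y i, fun a : ↥I₁ => y a)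
  have hr : ∀ i, Measurable (r i) := fun i => by fun_prop
  let A : Fin (n + 1) → Set (Fin (n + 1) → E) :=
    fun j => {y | (J.filter fun i => r i y < r j y).card < k}
  have hA : ∀ j, MeasurableSet (A j) := fun j => measurableSet_card_filter_lt J r hr j k
  have hsum : (k : ENNReal) ≤ ((I₂.card + 1 : ℕ) : ENNReal) * μ (A L) := by
    calc (k : ENNReal) ≤ ∑ j ∈ J, μ (A j) :=
          le_sum_measure_of_le_card_filter μ J A hA k fun y => by
            convert le_card_filter_card_filter_lt J (fun i => r i y) k (by omega) using 3
            rfl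
      _ = ∑ _j ∈ J, μ (A L) := Finset.sum_congr rfl fun j hj =>
          measure_card_filter_lt_eq_of_exchangeable μ hμ I₁ J hIJ φ hφ k hj
            (Finset.mem_insert_self L I₂)
      _ = ((I₂.card + 1 : ℕ) : ENNReal) * μ (A L) := by
          rw [Finset.sum_const, hcardJ, nsmul_eq_mul]
  have hcover : ENNReal.ofReal (1 - α) ≤ μ (A L) := by
    have hceil : ENNReal.ofReal (1 - α) * ((I₂.card + 1 : ℕ) : ENNReal) ≤ k := by
      rw [← ENNReal.ofReal_natCast, ← ENNReal.ofReal_natCast,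
        ← ENNReal.ofReal_mul (by linarith [hα.2])]
      refine ENNReal.ofReal_le_ofReal ?_
      push_cast
      exact Nat.le_ceil _
    have hmul := hceil.trans hsum
    rw [mul_comm] at hmul
    exact (ENNReal.mul_le_mul_iff_right (by simp) (ENNReal.natCast_ne_top _)).1 hmul
  refine hcover.trans ?_
  rw [hμdef, Measure.map_apply hYm (hA L)]
  refine measure_mono fun ω hω => ?_
  refine le_orderStat_of_countP_lt _ k _ (by simpa using hk) (lt_of_le_of_lt ?_ hω)
  rw [Multiset.countP_map]
  exact Finset.card_le_card (Finset.filter_subset_filter _ (Finset.subset_insert L I₂))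
end

section
/- Let R_1, …, R_{m+1} be exchangeable real-valued random variables on a probability space and let 1 ≤ k ≤ m+1. Then P(R_{m+1} ≤ Q) ≥ k/(m+1), where Q is the k-th order statistic of the full tuple (R_1, …, R_{m+1}). -/
open MeasureTheory

open Finset in
/-- A real with fewer than `k` entries strictly below it is at most the `k`-th order statistic. -/
theorem le_orderStat_of_card_lt {ι : Type*} [Fintype ι] (x : ι → ℝ) (a : ℝ) (k : ℕ)
    (hk1 : 1 ≤ k) (hk : k ≤ Fintype.card ι) (h : #{i | x i < a} < k) :
    a ≤ orderStat (Multiset.map x (univ : Finset ι).val) k := by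
  by_contra! hlt
  set s := Multiset.map x (univ : Finset ι).val with hs
  set l := s.sort (· ≤ ·) with hl
  have hlen : l.length = Fintype.card ι := by simp [hl, hs]
  have hsorted : l.Pairwise (· ≤ ·) := Multiset.pairwise_sort s (· ≤ ·)
  have hkl : k - 1 < l.length := by omega
  have hstat : orderStat s k = l[k - 1] := by
    rw [orderStat, ← hl, List.getD_eq_getElem _ _ hkl]
  rw [hstat] at hlt
  have hcount : l.countP (fun y => decide (y < a)) = #{i | x i < a} := by
    rw [← Multiset.coe_countP, hl, Multiset.sort_eq, hs, Multiset.countP_map]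
    rfl
  have htake : (l.take k).countP (fun y => decide (y < a)) = k := by
    have hall : ∀ y ∈ l.take k, decide (y < a) = true := by
      intro y hy
      obtain ⟨i, hi, rfl⟩ := List.mem_iff_getElem.mp hy
      simp only [List.length_take] at hi
      rw [List.getElem_take]
      have hle : l[i] ≤ l[k - 1] := by
        rcases (show i ≤ k - 1 by omega).eq_or_lt with rfl | hik
        · exact le_rfl
        · exact List.pairwise_iff_getElem.mp hsorted i (k - 1) _ _ hik
      simpa using hle.trans_lt hlt
    rw [List.countP_eq_length.mpr hall, List.length_take]
    omega
  have hsub := (List.take_sublist k l).countP_le (p := fun y => decide (y < a))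
  omega

open Finset in
/-- At least `k` entries of an `n`-tuple have fewer than `k` entries strictly below them. -/
theorem le_card_filter_card_lt {n : ℕ} (x : Fin n → ℝ) (k : ℕ) (hk : k ≤ n) :
    k ≤ #{j | #{i | x i < x j} < k} := by
  set σ := Tuple.sort x with hσ
  have hmono : Monotone (x ∘ σ) := Tuple.monotone_sort x
  have hsub : ((univ : Finset (Fin k)).map (Fin.castLEEmb hk)).map σ.toEmbedding ⊆
      ({j | #{i | x i < x j} < k} : Finset (Fin n)) := by
    intro j hj
    simp only [mem_map, mem_univ, true_and, exists_exists_eq_and] at hj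
    obtain ⟨p, rfl⟩ := hj
    set q : Fin n := Fin.castLEEmb hk p with hq
    have hbelow : ({i | x i < x (σ q)} : Finset (Fin n)) ⊆ (Iio q).map σ.toEmbedding := by
      intro i hi
      simp only [mem_filter, mem_univ, true_and] at hi
      refine mem_map.mpr ⟨σ.symm i, mem_Iio.mpr ?_, by simp⟩
      by_contra! hle
      exact absurd (hmono hle) (by simpa using hi)
    have hcard := card_le_card hbelow
    rw [card_map, Fin.card_Iio] at hcard
    have hqk : (q : ℕ) < k := p.isLt
    simpa using hcard.trans_lt hqk
  simpa using card_le_card hsub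

open Finset in
theorem measurableSet_card_lt {n : ℕ} (j : Fin n) (k : ℕ) :
    MeasurableSet {x : Fin n → ℝ | #{i | x i < x j} < k} := by
  simp only [card_filter]
  refine measurableSet_lt (Finset.measurable_sum _ fun i _ => ?_) measurable_const
  exact Measurable.ite (measurableSet_lt (measurable_pi_apply i) (measurable_pi_apply j))
    measurable_const measurable_const

/-- If `R 1, …, R (m+1)` are exchangeable real random variables and
`1 ≤ k ≤ m + 1`, then `P(R (m+1) ≤ Q) ≥ k / (m+1)`, where `Q` is the `k`-th order
statistic of the full tuple `(R 1, …, R (m+1))`. -/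
theorem exchangeable_le_orderStat_full
    {Ω : Type*} [MeasurableSpace Ω] (P : Measure Ω) [IsProbabilityMeasure P]
    (m : ℕ) (R : Fin (m + 1) → Ω → ℝ) (hR : ∀ i, Measurable (R i))
    (hexch : ∀ σ : Equiv.Perm (Fin (m + 1)),
      Measure.map (fun ω (i : Fin (m + 1)) => R (σ i) ω) P
        = Measure.map (fun ω (i : Fin (m + 1)) => R i ω) P)
    (k : ℕ) (hk1 : 1 ≤ k) (hkm : k ≤ m + 1) :
    ENNReal.ofReal ((k : ℝ) / (m + 1)) ≤
      P {ω | R (Fin.last m) ω ≤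
        orderStat (Multiset.map (fun i => R i ω) (Finset.univ : Finset (Fin (m + 1))).val) k} := by
  set A : Fin (m + 1) → Set Ω := fun j =>
    {ω | (Finset.univ.filter fun i => R i ω < R j ω).card < k} with hA
  have hmeas : ∀ σ : Equiv.Perm (Fin (m + 1)),
      Measurable fun ω (i : Fin (m + 1)) => R (σ i) ω :=
    fun σ => measurable_pi_lambda _ fun i => hR (σ i)
  have hAmeas : ∀ j, MeasurableSet (A j) := fun j =>
    measurable_pi_lambda _ hR (measurableSet_card_lt j k)
  have hAeq : ∀ j, P (A j) = P (A (Fin.last m)) := by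
    intro j
    have h := congrArg (fun μ => μ {x : Fin (m + 1) → ℝ |
      (Finset.univ.filter fun i => x i < x (Fin.last m)).card < k})
      (hexch (Equiv.swap j (Fin.last m)))
    beta_reduce at h
    rw [Measure.map_apply (hmeas _) (measurableSet_card_lt _ k),
      Measure.map_apply (measurable_pi_lambda _ hR) (measurableSet_card_lt _ k)] at h
    refine Eq.trans (congrArg P ?_) h
    ext ω
    simp only [hA, Set.mem_ofPred_eq, Set.mem_preimage, Equiv.swap_apply_right]
    rw [← Finset.card_map (Equiv.swap j (Fin.last m)).toEmbedding]
    suffices hset : (Finset.univ.filter fun i => R i ω < R j ω).map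
        (Equiv.swap j (Fin.last m)).toEmbedding =
        Finset.univ.filter fun i => R (Equiv.swap j (Fin.last m) i) ω < R j ω by rw [hset]
    ext i
    simp [Finset.mem_map_equiv]
  have hsum : (k : ENNReal) ≤ ∑ j, P (A j) := by
    calc (k : ENNReal) = ∫⁻ _, (k : ENNReal) ∂P := by simp
      _ ≤ ∫⁻ ω, ∑ j, (A j).indicator 1 ω ∂P := by
        refine lintegral_mono fun ω => ?_
        have h := le_card_filter_card_lt (fun i => R i ω) k hkm
        rw [Finset.card_filter] at h
        simp only [Set.indicator_apply, hA, Set.mem_ofPred_eq, Pi.one_apply]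
        exact_mod_cast h
      _ = ∑ j, P (A j) := by
        rw [lintegral_finsetSum _ fun j _ => measurable_one.indicator (hAmeas j)]
        simp [lintegral_indicator_one (hAmeas _)]
  have hlast : ENNReal.ofReal ((k : ℝ) / (m + 1)) ≤ P (A (Fin.last m)) := by
    simp only [hAeq, Finset.sum_const, Finset.card_univ, Fintype.card_fin, nsmul_eq_mul] at hsum
    rw [ENNReal.ofReal_div_of_pos (by positivity), ENNReal.ofReal_natCast,
      show ((m : ℝ) + 1) = ((m + 1 : ℕ) : ℝ) by push_cast; rfl, ENNReal.ofReal_natCast]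
    exact ENNReal.div_le_of_le_mul' hsum
  refine hlast.trans (measure_mono fun ω hω => ?_)
  exact le_orderStat_of_card_lt (fun i => R i ω) _ k hk1 (by simpa using hkm) hω
end
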